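/- The correlation P^G does not belong to ATOBL_{2→3}: there exist no finite set Λ, weights q(λ) ≥ 0 summing to 1, output-normalized distributions p₁(o₁|i₁,λ), and output-normalized distributions p₂₃(o₂o₃|i₂i₃,λ) whose marginal Σ_{o₃} p₂₃(o₂o₃|i₂i₃,λ) is independent of i₃, such that p^G(o₁o₂o₃|i₁i₂i₃) = Σ_λ q(λ)·p₁(o₁|i₁,λ)·p₂₃(o₂o₃|i₂i₃,λ). In particular P^G does not admit a time-ordered bilocal (TOBL) model across the partition 1|23. -/

import Mathlib

open scoped BigOperators

/-- A tripartite binary correlation: `p o1 o2 o3 i1 i2 i3` is the probability of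
outputs `(o1,o2,o3)` given inputs `(i1,i2,i3)`, all binary. -/
abbrev TriCorr := Fin 2 → Fin 2 → Fin 2 → Fin 2 → Fin 2 → Fin 2 → ℝ

/-- `p` is a valid tripartite binary correlation: nonnegative and normalized. -/
def IsTriCorr (p : TriCorr) : Prop :=
  (∀ o1 o2 o3 i1 i2 i3, 0 ≤ p o1 o2 o3 i1 i2 i3) ∧
  (∀ i1 i2 i3, (∑ o1, ∑ o2, ∑ o3, p o1 o2 o3 i1 i2 i3) = 1)

/-- `p` admits a 2←3 asymmetric time-ordered bilocal model across 1|23: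
bilocal decomposition whose bipartite terms are no-signaling from party 2 to
party 3 (the marginal `∑ o2, p23 l o2 o3 i2 i3` is independent of `i2`). -/
def ATOBL_left (p : TriCorr) : Prop :=
  ∃ (n : ℕ) (q : Fin n → ℝ)
    (p1 : Fin n → Fin 2 → Fin 2 → ℝ)
    (p23 : Fin n → Fin 2 → Fin 2 → Fin 2 → Fin 2 → ℝ),
    (∀ l, 0 ≤ q l) ∧ (∑ l, q l) = 1 ∧
    (∀ l o1 i1, 0 ≤ p1 l o1 i1) ∧ (∀ l i1, (∑ o1, p1 l o1 i1) = 1) ∧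
    (∀ l o2 o3 i2 i3, 0 ≤ p23 l o2 o3 i2 i3) ∧
    (∀ l i2 i3, (∑ o2, ∑ o3, p23 l o2 o3 i2 i3) = 1) ∧
    (∀ l o3 i2 i2' i3, (∑ o2, p23 l o2 o3 i2 i3) = ∑ o2, p23 l o2 o3 i2' i3) ∧
    (∀ o1 o2 o3 i1 i2 i3,
      p o1 o2 o3 i1 i2 i3 = ∑ l, q l * p1 l o1 i1 * p23 l o2 o3 i2 i3)

/-- `p` admits a 2→3 asymmetric time-ordered bilocal model across 1|23:
bilocal decomposition whose bipartite terms are no-signaling from party 3 to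
party 2 (the marginal `∑ o3, p23 l o2 o3 i2 i3` is independent of `i3`). -/
def ATOBL_right (p : TriCorr) : Prop :=
  ∃ (n : ℕ) (q : Fin n → ℝ)
    (p1 : Fin n → Fin 2 → Fin 2 → ℝ)
    (p23 : Fin n → Fin 2 → Fin 2 → Fin 2 → Fin 2 → ℝ),
    (∀ l, 0 ≤ q l) ∧ (∑ l, q l) = 1 ∧
    (∀ l o1 i1, 0 ≤ p1 l o1 i1) ∧ (∀ l i1, (∑ o1, p1 l o1 i1) = 1) ∧
    (∀ l o2 o3 i2 i3, 0 ≤ p23 l o2 o3 i2 i3) ∧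
    (∀ l i2 i3, (∑ o2, ∑ o3, p23 l o2 o3 i2 i3) = 1) ∧
    (∀ l o2 i2 i3 i3', (∑ o3, p23 l o2 o3 i2 i3) = ∑ o3, p23 l o2 o3 i2 i3') ∧
    (∀ o1 o2 o3 i1 i2 i3,
      p o1 o2 o3 i1 i2 i3 = ∑ l, q l * p1 l o1 i1 * p23 l o2 o3 i2 i3)

/-- The Gallego et al. GHZ correlation `P^G`. -/
noncomputable def pG : TriCorr := fun o1 o2 o3 i1 i2 i3 =>
  (1 / 8) * (1
    + (-1 : ℝ) ^ (o1.val + o2.val) * (if i1 = 0 then 1 else 0) * (if i2 = 0 then 1 else 0)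
    + (1 / Real.sqrt 2) * (-1 : ℝ) ^ (o1.val + o3.val) * (if i1 = 0 then 1 else 0)
    + (1 / Real.sqrt 2) * (-1 : ℝ) ^ (o2.val + o3.val) * (if i2 = 0 then 1 else 0)
    + (1 / Real.sqrt 2) * (-1 : ℝ) ^ (i3.val + o1.val + o2.val + o3.val)
        * (if i1 = 1 then 1 else 0) * (if i2 = 1 then 1 else 0))

/-- The CHSH expression between party 1 and party 3 in which party 2 has input `1` and the second
observable of party 1 is multiplied by the outcome of party 2. -/
noncomputable def chshGivenParty2 (p : TriCorr) : ℝ :=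
  ∑ o1 : Fin 2, ∑ o2 : Fin 2, ∑ o3 : Fin 2,
    ((-1 : ℝ) ^ (o1.val + o3.val) * (p o1 o2 o3 0 1 0 + p o1 o2 o3 0 1 1)
      + (-1 : ℝ) ^ (o1.val + o2.val + o3.val) * (p o1 o2 o3 1 1 0 - p o1 o2 o3 1 1 1))

lemma chshGivenParty2_pG : chshGivenParty2 pG = 4 / Real.sqrt 2 := by
  simp [chshGivenParty2, pG, Fin.sum_univ_two]
  ring

lemma chshGivenParty2_mixture {n : ℕ} (q : Fin n → ℝ) (r : Fin n → TriCorr) :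
    chshGivenParty2 (fun o1 o2 o3 i1 i2 i3 => ∑ l, q l * r l o1 o2 o3 i1 i2 i3)
      = ∑ l, q l * chshGivenParty2 (r l) := by
  simp only [chshGivenParty2, Fin.sum_univ_two, Finset.mul_sum, ← Finset.sum_add_distrib,
    ← Finset.sum_sub_distrib]
  exact Finset.sum_congr rfl fun l _ => by ring

lemma chsh_le {a b x y m : ℝ} (ha : |a| ≤ 1) (hb : |b| ≤ 1) (hx : |x| ≤ m) (hy : |y| ≤ m) :
    a * (x + y) + b * (x - y) ≤ 2 * m := by
  have h1 : a * (x + y) ≤ |x + y| := (le_abs_self _).trans <| by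
    rw [abs_mul]; exact mul_le_of_le_one_left (abs_nonneg _) ha
  have h2 : b * (x - y) ≤ |x - y| := (le_abs_self _).trans <| by
    rw [abs_mul]; exact mul_le_of_le_one_left (abs_nonneg _) hb
  have h3 : |x + y| + |x - y| ≤ 2 * m := by
    rw [abs_le] at hx hy
    rcases abs_cases (x + y) with h | h <;> rcases abs_cases (x - y) with h' | h' <;> linarith
  linarith

lemma abs_sub_le_add {a b : ℝ} (ha : 0 ≤ a) (hb : 0 ≤ b) : |a - b| ≤ a + b :=
  abs_le.2 ⟨by linarith, by linarith⟩

lemma chshGivenParty2_product_le (p1 : Fin 2 → Fin 2 → ℝ) (p23 : Fin 2 → Fin 2 → Fin 2 → Fin 2 → ℝ)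
    (hp1 : ∀ o1 i1, 0 ≤ p1 o1 i1) (hp1_sum : ∀ i1, ∑ o1, p1 o1 i1 = 1)
    (hp23 : ∀ o2 o3 i2 i3, 0 ≤ p23 o2 o3 i2 i3)
    (hp23_sum : ∀ i2 i3, ∑ o2, ∑ o3, p23 o2 o3 i2 i3 = 1)
    (hns : ∀ o2 i2 i3 i3', ∑ o3, p23 o2 o3 i2 i3 = ∑ o3, p23 o2 o3 i2 i3') :
    chshGivenParty2 (fun o1 o2 o3 i1 i2 i3 => p1 o1 i1 * p23 o2 o3 i2 i3) ≤ 2 := by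
  simp only [Fin.sum_univ_two] at hp1_sum hp23_sum hns
  have hA (i1 : Fin 2) : |p1 0 i1 - p1 1 i1| ≤ 1 :=
    hp1_sum i1 ▸ abs_sub_le_add (hp1 0 i1) (hp1 1 i1)
  have hC (o2 i3 : Fin 2) : |p23 o2 0 1 i3 - p23 o2 1 1 i3| ≤ p23 o2 0 1 0 + p23 o2 1 1 0 :=
    hns o2 1 i3 0 ▸ abs_sub_le_add (hp23 o2 0 1 i3) (hp23 o2 1 1 i3)
  have h0 := chsh_le (hA 0) (hA 1) (hC 0 0) (hC 0 1)
  have h1 := chsh_le (hA 0) (abs_neg (p1 0 1 - p1 1 1) ▸ hA 1) (hC 1 0) (hC 1 1)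
  have hnorm := hp23_sum 1 0
  simp [chshGivenParty2, Fin.sum_univ_two]
  linarith

lemma chshGivenParty2_le_of_ATOBL_right {p : TriCorr} (hp : ATOBL_right p) :
    chshGivenParty2 p ≤ 2 := by
  obtain ⟨n, q, p1, p23, hq, hq_sum, hp1, hp1_sum, hp23, hp23_sum, hns, hp⟩ := hp
  have hp' : p = fun o1 o2 o3 i1 i2 i3 => ∑ l, q l * (p1 l o1 i1 * p23 l o2 o3 i2 i3) := by
    funext o1 o2 o3 i1 i2 i3
    simp only [hp, mul_assoc]
  rw [hp', chshGivenParty2_mixture q fun l o1 o2 o3 i1 i2 i3 => p1 l o1 i1 * p23 l o2 o3 i2 i3]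
  calc _ ≤ ∑ l, q l * 2 := Finset.sum_le_sum fun l _ => mul_le_mul_of_nonneg_left
        (chshGivenParty2_product_le (p1 l) (p23 l) (hp1 l) (hp1_sum l) (hp23 l) (hp23_sum l)
          (hns l)) (hq l)
    _ = 2 := by rw [← Finset.sum_mul, hq_sum, one_mul]

/-- `P^G ∉ ATOBL_{2→3}`; in particular `P^G` admits no TOBL model across 1|23. -/
theorem pG_not_ATOBL_right :
    ¬ ATOBL_right pG ∧ ¬ (ATOBL_right pG ∧ ATOBL_left pG) := by
  have h : ¬ ATOBL_right pG := fun h => by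
    have hle := chshGivenParty2_le_of_ATOBL_right h
    rw [chshGivenParty2_pG, div_le_iff₀ (by positivity)] at hle
    nlinarith [Real.sq_sqrt (show (0 : ℝ) ≤ 2 by norm_num), Real.sqrt_nonneg 2]
  exact ⟨h, fun h' => h h'.1⟩
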